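/- arXiv:2204.13005 — 2 statements merged into one kernel-verified Lean document; each statement's English description precedes it below -/
import Mathlib

section
/- (L² boundedness of the Laplace transform.) For every function φ ∈ L²((0,∞); ℂ), the function x ↦ ∫₀^∞ e^{-kx} φ(k) dk belongs to L²((0,∞); ℂ) and satisfies ‖x ↦ ∫₀^∞ e^{-kx} φ(k) dk‖_{L²(0,∞)} ≤ √π · ‖φ‖_{L²(0,∞)}. -/
open MeasureTheory Set

open scoped ENNReal

/-- Cauchy–Schwarz inequality for the lower Lebesgue integral. -/
theorem sq_lintegral_mul_le {α : Type*} [MeasurableSpace α] {μ : Measure α} {u v : α → ℝ≥0∞}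
    (hu : AEMeasurable u μ) (hv : AEMeasurable v μ) :
    (∫⁻ a, u a * v a ∂μ) ^ 2 ≤ (∫⁻ a, u a ^ 2 ∂μ) * ∫⁻ a, v a ^ 2 ∂μ := by
  have h := ENNReal.lintegral_mul_le_Lp_mul_Lq μ Real.HolderConjugate.two_two hu hv
  simp only [Pi.mul_apply, ENNReal.rpow_two] at h
  calc (∫⁻ a, u a * v a ∂μ) ^ 2
      ≤ ((∫⁻ a, u a ^ 2 ∂μ) ^ (1 / 2 : ℝ) * (∫⁻ a, v a ^ 2 ∂μ) ^ (1 / 2 : ℝ)) ^ 2 := by gcongr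
    _ = (∫⁻ a, u a ^ 2 ∂μ) * ∫⁻ a, v a ^ 2 ∂μ := by
      rw [mul_pow, ← ENNReal.rpow_two, ← ENNReal.rpow_two, ← ENNReal.rpow_mul, ← ENNReal.rpow_mul]
      norm_num

theorem lintegral_rpow_neg_half_mul_exp_neg_mul {b : ℝ} (hb : 0 < b) :
    ∫⁻ t in Ioi (0 : ℝ), ENNReal.ofReal (t ^ (-(1 / 2) : ℝ) * Real.exp (-(t * b))) =
      ENNReal.ofReal (√Real.pi * b ^ (-(1 / 2) : ℝ)) := by
  rw [← ofReal_integral_eq_lintegral_ofReal]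
  · have h := Real.integral_rpow_mul_exp_neg_mul_Ioi (a := 1 / 2) (by norm_num) hb
    rw [Real.Gamma_one_half_eq, one_div b, Real.inv_rpow hb.le, ← Real.rpow_neg hb.le] at h
    rw [mul_comm, ← h]
    norm_num [mul_comm b]
  · have h := integrableOn_rpow_mul_exp_neg_mul_rpow (s := -(1 / 2)) (by norm_num) one_pos hb
    simpa [IntegrableOn, mul_comm b] using h
  · filter_upwards [self_mem_ae_restrict measurableSet_Ioi] with t ht
    have : 0 < t := ht
    positivity

/-- Schur's test for the Laplace kernel, pointwise part, with weight `k ^ (-1/2)`. -/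
theorem sq_lintegral_exp_neg_mul_le {f : ℝ → ℝ≥0∞}
    (hf : AEMeasurable f (volume.restrict (Ioi (0 : ℝ)))) {x : ℝ} (hx : 0 < x) :
    (∫⁻ k in Ioi (0 : ℝ), ENNReal.ofReal (Real.exp (-(k * x))) * f k) ^ 2 ≤
      ENNReal.ofReal (√Real.pi * x ^ (-(1 / 2) : ℝ)) *
        ∫⁻ k in Ioi (0 : ℝ), ENNReal.ofReal (k ^ (1 / 2 : ℝ) * Real.exp (-(k * x))) * f k ^ 2 := by
  set u : ℝ → ℝ≥0∞ := fun k ↦ ENNReal.ofReal (k ^ (-(1 / 4) : ℝ) * Real.exp (-(k * x) / 2))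
  set v : ℝ → ℝ≥0∞ := fun k ↦ ENNReal.ofReal (k ^ (1 / 4 : ℝ) * Real.exp (-(k * x) / 2)) * f k
  have exp_sq (k : ℝ) : Real.exp (-(k * x) / 2) ^ 2 = Real.exp (-(k * x)) := by
    rw [← Real.exp_nat_mul]; congr 1; push_cast; ring
  have h := sq_lintegral_mul_le (μ := volume.restrict (Ioi (0 : ℝ))) (u := u) (v := v)
    (by fun_prop) (by fun_prop)
  convert h using 2
  · refine setLIntegral_congr_fun measurableSet_Ioi fun k (hk : 0 < k) ↦ ?_
    simp only [u, v]
    rw [← mul_assoc, ← ENNReal.ofReal_mul (by positivity), mul_mul_mul_comm, ← Real.rpow_add hk,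
      ← sq, exp_sq]
    norm_num
  · rw [← lintegral_rpow_neg_half_mul_exp_neg_mul hx]
    refine setLIntegral_congr_fun measurableSet_Ioi fun k (hk : 0 < k) ↦ ?_
    simp only [u]
    rw [← ENNReal.ofReal_pow (by positivity), mul_pow, exp_sq, ← Real.rpow_mul_natCast hk.le]
    norm_num
  · refine setLIntegral_congr_fun measurableSet_Ioi fun k (hk : 0 < k) ↦ ?_
    simp only [v]
    rw [mul_pow, ← ENNReal.ofReal_pow (by positivity), mul_pow, exp_sq,
      ← Real.rpow_mul_natCast hk.le]
    norm_num

theorem lintegral_sq_lintegral_exp_neg_mul_le {f : ℝ → ℝ≥0∞}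
    (hf : AEMeasurable f (volume.restrict (Ioi (0 : ℝ)))) :
    ∫⁻ x in Ioi (0 : ℝ), (∫⁻ k in Ioi (0 : ℝ), ENNReal.ofReal (Real.exp (-(k * x))) * f k) ^ 2 ≤
      ENNReal.ofReal Real.pi * ∫⁻ k in Ioi (0 : ℝ), f k ^ 2 := by
  calc _ ≤ ∫⁻ x in Ioi (0 : ℝ), ∫⁻ k in Ioi (0 : ℝ),
        ENNReal.ofReal (√Real.pi * x ^ (-(1 / 2) : ℝ)) *
          (ENNReal.ofReal (k ^ (1 / 2 : ℝ) * Real.exp (-(k * x))) * f k ^ 2) :=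
        setLIntegral_mono' measurableSet_Ioi fun x hx ↦ by
          rw [lintegral_const_mul' _ _ ENNReal.ofReal_ne_top]
          exact sq_lintegral_exp_neg_mul_le hf hx
    _ = ∫⁻ k in Ioi (0 : ℝ), ∫⁻ x in Ioi (0 : ℝ),
        ENNReal.ofReal (√Real.pi * x ^ (-(1 / 2) : ℝ)) *
          (ENNReal.ofReal (k ^ (1 / 2 : ℝ) * Real.exp (-(k * x))) * f k ^ 2) :=
        lintegral_lintegral_swap (by unfold Function.uncurry; fun_prop)
    _ = ∫⁻ k in Ioi (0 : ℝ), ENNReal.ofReal Real.pi * f k ^ 2 := by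
        refine setLIntegral_congr_fun measurableSet_Ioi fun k (hk : 0 < k) ↦ ?_
        calc _ = ∫⁻ x in Ioi (0 : ℝ), ENNReal.ofReal (√Real.pi * k ^ (1 / 2 : ℝ)) *
              ENNReal.ofReal (x ^ (-(1 / 2) : ℝ) * Real.exp (-(x * k))) * f k ^ 2 := by
              refine setLIntegral_congr_fun measurableSet_Ioi fun x (hx : 0 < x) ↦ ?_
              rw [← mul_assoc, ← ENNReal.ofReal_mul (by positivity),
                ← ENNReal.ofReal_mul (by positivity), mul_comm x k]
              congr 2
              ring
          _ = ENNReal.ofReal Real.pi * f k ^ 2 := by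
              rw [lintegral_mul_const _ (by fun_prop), lintegral_const_mul _ (by fun_prop),
                lintegral_rpow_neg_half_mul_exp_neg_mul hk, ← ENNReal.ofReal_mul (by positivity),
                mul_mul_mul_comm, ← Real.rpow_add hk, Real.mul_self_sqrt Real.pi_pos.le]
              norm_num
    _ = _ := lintegral_const_mul' _ _ ENNReal.ofReal_ne_top

/-- L² boundedness of the Laplace transform on (0,∞) with constant √π. -/
theorem laplace_transform_L2_bound (φ : ℝ → ℂ)
    (hφ : MemLp φ 2 (volume.restrict (Ioi (0:ℝ)))) :
    MemLp (fun x : ℝ => ∫ k in Ioi (0:ℝ), (Real.exp (-(k * x)) : ℂ) * φ k) 2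
      (volume.restrict (Ioi (0:ℝ))) ∧
    eLpNorm (fun x : ℝ => ∫ k in Ioi (0:ℝ), (Real.exp (-(k * x)) : ℂ) * φ k) 2
      (volume.restrict (Ioi (0:ℝ)))
      ≤ ENNReal.ofReal (Real.sqrt Real.pi) * eLpNorm φ 2 (volume.restrict (Ioi (0:ℝ))) := by
  have hsq (g : ℝ → ℂ) : eLpNorm g 2 (volume.restrict (Ioi (0 : ℝ))) ^ 2 =
      ∫⁻ x in Ioi (0 : ℝ), ‖g x‖ₑ ^ 2 := by
    simpa using eLpNorm_nnreal_pow_eq_lintegral (f := g) (p := 2)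
      (μ := volume.restrict (Ioi (0 : ℝ))) two_ne_zero
  have hbound : eLpNorm (fun x : ℝ ↦ ∫ k in Ioi (0 : ℝ), (Real.exp (-(k * x)) : ℂ) * φ k) 2
      (volume.restrict (Ioi (0 : ℝ))) ≤
      ENNReal.ofReal √Real.pi * eLpNorm φ 2 (volume.restrict (Ioi (0 : ℝ))) := by
    rw [← ENNReal.pow_le_pow_left_iff two_ne_zero, mul_pow, hsq, hsq,
      ← ENNReal.ofReal_pow (by positivity), Real.sq_sqrt Real.pi_pos.le]
    refine le_trans (lintegral_mono fun x ↦ ?_)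
      (lintegral_sq_lintegral_exp_neg_mul_le hφ.aestronglyMeasurable.enorm)
    gcongr
    refine (enorm_integral_le_lintegral_enorm _).trans_eq (lintegral_congr fun k ↦ ?_)
    rw [enorm_mul, ← ofReal_norm, Complex.norm_of_nonneg (Real.exp_pos _).le]
  refine ⟨⟨?_, hbound.trans_lt (ENNReal.mul_lt_top ENNReal.ofReal_lt_top hφ.2)⟩, hbound⟩
  have hm : AEStronglyMeasurable (fun p : ℝ × ℝ ↦ (Real.exp (-(p.2 * p.1)) : ℂ) * φ p.2)
      ((volume.restrict (Ioi (0 : ℝ))).prod (volume.restrict (Ioi (0 : ℝ)))) :=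
    (by fun_prop : Continuous fun p : ℝ × ℝ ↦
      (Real.exp (-(p.2 * p.1)) : ℂ)).aestronglyMeasurable.mul hφ.aestronglyMeasurable.comp_snd
  exact hm.integral_prod_right'
end

section
/- (Pointwise convolution bound on the semicircle.) Let ψ : ℝ → ℂ be defined by ψ(t) = e^{-t} for t ∈ (0,2) and ψ(t) = 0 otherwise. There exists a universal constant C > 0 with the following property. Let h : ℝ → ℂ be measurable with h ∈ L¹(ℝ) ∩ L²(ℝ) and supp(h) ⊆ [0,2], let k₁ ∈ ℝ, and let z ∈ ℂ with Im(z) ≥ 0. Define ĥ(τ) = ∫_ℝ e^{-iτt} h(t) dt for τ ∈ ℝ, ĥ at the complex point -k₁²-z by ĥ(-k₁²-z) = ∫₀² e^{i(k₁²+z)t} h(t) dt, and ψ̂(-z) = ∫₀² e^{izt} e^{-t} dt. Then |ψ̂(-z) · ĥ(-k₁²-z)|² ≤ C ∫_{ℝ} (1+(τ+k₁²)²)^{-1} |ĥ(τ)|² dτ. -/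
open MeasureTheory Set
open scoped ENNReal NNReal

open FourierTransform Convolution

/-- The pointwise Fourier transform of a function in `L¹ ∩ L²` represents its `L²` Fourier
transform. -/
lemma fourier_toLp_ae_eq {f : ℝ → ℂ} (hf : Integrable f) (hf2 : MemLp f 2 volume) :
    (𝓕 (hf2.toLp f) : Lp (α := ℝ) ℂ 2 volume) =ᵐ[volume] 𝓕 f := by
  have hcont : Continuous (𝓕 f) :=
    VectorFourier.fourierIntegral_continuous Real.continuous_fourierChar
      (L := innerₗ ℝ) continuous_inner hf
  refine ae_eq_of_integral_contDiff_smul_eq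
    ((Lp.memLp (𝓕 (hf2.toLp f) : Lp (α := ℝ) ℂ 2 volume)).locallyIntegrable one_le_two)
    hcont.locallyIntegrable ?_
  intro g hg hgc
  have hgc' : HasCompactSupport (fun x => (g x : ℂ)) :=
    hgc.comp_left (g := ((↑) : ℝ → ℂ)) Complex.ofReal_zero
  have hg' : ContDiff ℝ ((⊤ : ℕ∞) : WithTop ℕ∞) (fun x => (g x : ℂ)) :=
    Complex.ofRealCLM.contDiff.comp hg
  obtain ⟨G, hG⟩ : ∃ G : SchwartzMap ℝ ℂ, ∀ x, G x = (g x : ℂ) :=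
    ⟨hgc'.toSchwartzMap hg', fun _ => rfl⟩
  have hdist := congrArg (fun T => T G) (Lp.fourier_toTemperedDistribution_eq (hf2.toLp f))
  simp only [TemperedDistribution.fourier_apply, Lp.toTemperedDistribution_apply] at hdist
  have hswap : ∫ x, 𝓕 (G : ℝ → ℂ) x • f x = ∫ x, G x • 𝓕 f x := by
    simpa using! VectorFourier.integral_fourierIntegral_smul_eq_flip (L := innerₗ ℝ)
      Real.continuous_fourierChar continuous_inner (G.integrable (μ := volume)) hf
  have hl : ∫ x, (𝓕 G) x • (hf2.toLp f) x = ∫ x, 𝓕 (G : ℝ → ℂ) x • f x := by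
    refine integral_congr_ae ?_
    filter_upwards [hf2.coeFn_toLp] with x hx
    rw [hx, SchwartzMap.fourier_coe]
  rw [hl, hswap] at hdist
  simpa [hG, Complex.real_smul] using hdist.symm

/-- **Plancherel's theorem** for the Fourier integral on `L¹ ∩ L²`. -/
lemma eLpNorm_fourier_eq {f : ℝ → ℂ} (hf : Integrable f) (hf2 : MemLp f 2 volume) :
    eLpNorm (𝓕 f) 2 volume = eLpNorm f 2 volume := by
  rw [← eLpNorm_congr_ae (fourier_toLp_ae_eq hf hf2), ← Lp.enorm_def, ← ofReal_norm,
    Lp.norm_fourier_eq, ofReal_norm, Lp.enorm_toLp]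

lemma lintegral_enorm_sq_eq_eLpNorm_sq (f : ℝ → ℂ) :
    ∫⁻ x, ‖f x‖ₑ ^ 2 = eLpNorm f 2 volume ^ 2 := by
  simpa using (eLpNorm_nnreal_pow_eq_lintegral (f := f) (μ := volume) (p := 2) two_ne_zero).symm

/-- Cauchy–Schwarz for a function supported in a set. -/
lemma sq_lintegral_enorm_le_of_support_subset {f : ℝ → ℂ} {s : Set ℝ}
    (hf : AEStronglyMeasurable f) (hs : Function.support f ⊆ s) :
    (∫⁻ x, ‖f x‖ₑ) ^ 2 ≤ volume s * ∫⁻ x, ‖f x‖ₑ ^ 2 := by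
  have hr : ∫⁻ x, ‖f x‖ₑ = eLpNorm f 1 (volume.restrict s) := by
    rw [eLpNorm_one_eq_lintegral_enorm]
    refine (setLIntegral_eq_of_support_subset ?_).symm
    intro x hx
    exact hs (by simpa using hx)
  have hcs := eLpNorm_le_eLpNorm_mul_rpow_measure_univ (p := 1) (q := 2) one_le_two
    (hf.restrict (s := s))
  have hm := eLpNorm_mono_measure f (p := 2) (Measure.restrict_le_self (μ := volume) (s := s))
  rw [hr, lintegral_enorm_sq_eq_eLpNorm_sq]
  calc _ ≤ (eLpNorm f 2 volume * volume s ^ (1 / 2 : ℝ)) ^ 2 := by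
        refine pow_le_pow_left₀ zero_le (hcs.trans ?_) 2
        norm_num
        gcongr
    _ = _ := by
        rw [mul_pow, ← ENNReal.rpow_natCast (_ ^ _), ← ENNReal.rpow_mul]
        norm_num [mul_comm]

/-- The exponential `e^{-t}` truncated to `(0, 2]`. -/
noncomputable def truncExp : ℝ → ℂ := (Ioc 0 2).indicator fun t => Complex.exp (-(t : ℂ))

lemma support_truncExp_subset : Function.support truncExp ⊆ Icc 0 2 :=
  Set.support_indicator_subset.trans Ioc_subset_Icc_self

lemma norm_truncExp_le (t : ℝ) : ‖truncExp t‖ ≤ 1 := by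
  rw [truncExp, norm_indicator_eq_indicator_norm]
  refine indicator_le' (fun t ht => ?_) (fun _ _ => zero_le_one) t
  simpa [Complex.norm_exp] using ht.1.le

lemma integrable_mul_truncExp {c : ℝ → ℂ} (hc : Continuous c) :
    Integrable fun t => c t * truncExp t := by
  have : (fun t => c t * truncExp t) =
      (Ioc 0 2).indicator fun t => c t * Complex.exp (-(t : ℂ)) := by
    ext t; simp [truncExp, indicator_apply]
  rw [this, integrable_indicator_iff measurableSet_Ioc]
  exact (Continuous.integrableOn_Icc (by fun_prop)).mono_set Ioc_subset_Icc_self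

lemma integral_mul_truncExp (c : ℝ → ℂ) :
    ∫ t, c t * truncExp t = ∫ t in (0 : ℝ)..2, c t * Complex.exp (-(t : ℂ)) := by
  rw [intervalIntegral.integral_of_le zero_le_two, ← integral_indicator measurableSet_Ioc]
  congr 1; ext t; simp [truncExp, indicator_apply]

lemma Real.fourier_eq_integral_cexp_mul (f : ℝ → ℂ) (ξ : ℝ) :
    𝓕 f ξ = ∫ t : ℝ, Complex.exp (-Complex.I * ((2 * Real.pi * ξ : ℝ) : ℂ) * t) * f t := by
  rw [Real.fourier_real_eq_integral_exp_smul]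
  congr 1; ext t
  rw [smul_eq_mul]
  congr 2
  push_cast; ring

lemma norm_sq_fourier_truncExp_le (ξ : ℝ) :
    ‖𝓕 truncExp ξ‖ ^ 2 ≤ 4 * (1 + (2 * Real.pi * ξ) ^ 2)⁻¹ := by
  rw [Real.fourier_eq_integral_cexp_mul, integral_mul_truncExp]
  generalize 2 * Real.pi * ξ = θ
  set c : ℂ := -(1 + Complex.I * θ) with hc
  have hre : c.re = -1 := by simp [hc]
  have him : c.im = -θ := by simp [hc]
  have hc0 : c ≠ 0 := fun h => by simp [h] at hre
  have : ∀ t : ℝ, Complex.exp (-Complex.I * θ * t) * Complex.exp (-(t : ℂ)) =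
      Complex.exp (c * t) := fun t => by rw [← Complex.exp_add]; congr 1; rw [hc]; ring
  simp_rw [this]
  rw [integral_exp_mul_complex hc0, norm_div, div_pow, div_eq_mul_inv, ← Complex.normSq_eq_norm_sq c,
    Complex.normSq_apply, hre, him]
  have h1 : ‖Complex.exp (c * (2 : ℝ)) - Complex.exp (c * (0 : ℝ))‖ ≤ 2 := by
    refine (norm_sub_le _ _).trans ?_
    have : ‖Complex.exp (c * (2 : ℝ))‖ ≤ 1 := by simp [Complex.norm_exp, hre]
    have h0 : ‖Complex.exp (c * (0 : ℝ))‖ = 1 := by simp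
    linarith
  have h2 : (-1 : ℝ) * -1 + -θ * -θ = 1 + θ ^ 2 := by ring
  rw [h2]
  gcongr
  nlinarith [norm_nonneg (Complex.exp (c * (2 : ℝ)) - Complex.exp (c * (0 : ℝ)))]

/-- Affine change of variables for the lower Lebesgue integral. -/
lemma lintegral_comp_mul_left_sub {c : ℝ} (hc : 1 ≤ c) (a : ℝ) (f : ℝ → ℝ≥0∞) :
    ∫⁻ x, f (c * x - a) ≤ ∫⁻ x, f x := by
  have hc0 : c ≠ 0 := by positivity
  have e : MeasurableEmbedding (c * · : ℝ → ℝ) := (Homeomorph.mulLeft₀ c hc0).measurableEmbedding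
  rw [← lintegral_sub_right_eq_self f a]
  nth_rw 2 [← Real.smul_map_volume_mul_left hc0]
  rw [lintegral_smul_measure, e.lintegral_map]
  refine le_mul_of_one_le_left zero_le ?_
  rw [abs_of_pos (by positivity)]
  exact ENNReal.one_le_ofReal.2 hc

/-- `‖ψ ⋆ f‖₂` in terms of the Fourier transforms, for `ψ` the truncated exponential. -/
lemma lintegral_enorm_sq_truncExp_convolution_le {f : ℝ → ℂ} (hf : Integrable f) :
    ∫⁻ t, ‖(truncExp ⋆[ContinuousLinearMap.mul ℂ ℂ] f) t‖ₑ ^ 2 ≤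
      ∫⁻ ξ : ℝ, ENNReal.ofReal (4 * (1 + (2 * Real.pi * ξ) ^ 2)⁻¹) * ‖𝓕 f ξ‖ₑ ^ 2 := by
  have hψ : Integrable truncExp := by
    simpa using integrable_mul_truncExp (c := fun _ => 1) continuous_const
  set F := truncExp ⋆[ContinuousLinearMap.mul ℂ ℂ] f with hF
  have hFi : Integrable F := hψ.integrable_convolution _ hf
  have hbd (t : ℝ) : ‖F t‖ ≤ ∫ s, ‖f s‖ := by
    rw [hF, convolution_eq_swap]
    refine norm_integral_le_of_norm_le hf.norm (Filter.Eventually.of_forall fun s => ?_)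
    simpa using mul_le_of_le_one_left (norm_nonneg (f s)) (norm_truncExp_le (t - s))
  have hF2 : MemLp F 2 volume := by
    rw [memLp_two_iff_integrable_sq_norm hFi.1]
    simp_rw [sq]
    exact hFi.norm.bdd_mul hFi.1.norm (Filter.Eventually.of_forall fun t => by simpa using hbd t)
  rw [lintegral_enorm_sq_eq_eLpNorm_sq, ← eLpNorm_fourier_eq hFi hF2,
    ← lintegral_enorm_sq_eq_eLpNorm_sq]
  refine lintegral_mono fun ξ => ?_
  rw [hF, Real.fourier_mul_convolution_eq hψ hf, enorm_mul, mul_pow]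
  gcongr
  rw [← ofReal_norm, ← ENNReal.ofReal_pow (norm_nonneg _)]
  exact ENNReal.ofReal_le_ofReal (norm_sq_fourier_truncExp_le ξ)

lemma norm_cexp_I_mul_le_one {z : ℂ} (hz : 0 ≤ z.im) {t : ℝ} (ht : 0 ≤ t) :
    ‖Complex.exp (Complex.I * z * t)‖ ≤ 1 := by
  rw [Complex.norm_exp, Real.exp_le_one_iff]
  simpa using mul_nonneg hz ht

/-- A product of Laplace-type integrals is bounded by the `L¹` norm of the convolution. -/
lemma enorm_integral_mul_integral_le {f g : ℝ → ℂ} {z : ℂ} (hz : 0 ≤ z.im)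
    (hf : Integrable fun t : ℝ => Complex.exp (Complex.I * z * t) * f t)
    (hg : Integrable fun t : ℝ => Complex.exp (Complex.I * z * t) * g t)
    (hfg : Function.support (f ⋆[ContinuousLinearMap.mul ℂ ℂ] g) ⊆ Ici 0) :
    ‖(∫ t : ℝ, Complex.exp (Complex.I * z * t) * f t) *
        ∫ t : ℝ, Complex.exp (Complex.I * z * t) * g t‖ₑ ≤
      ∫⁻ t, ‖(f ⋆[ContinuousLinearMap.mul ℂ ℂ] g) t‖ₑ := by
  have hconv := integral_convolution (ContinuousLinearMap.mul ℂ ℂ) hf hg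
  rw [ContinuousLinearMap.mul_apply'] at hconv
  rw [← hconv]
  refine (enorm_integral_le_lintegral_enorm _).trans (lintegral_mono fun t => ?_)
  have : ((fun t : ℝ => Complex.exp (Complex.I * z * t) * f t) ⋆[ContinuousLinearMap.mul ℂ ℂ]
      fun t : ℝ => Complex.exp (Complex.I * z * t) * g t) t =
      Complex.exp (Complex.I * z * t) * (f ⋆[ContinuousLinearMap.mul ℂ ℂ] g) t := by
    simp only [convolution_def, ContinuousLinearMap.mul_apply', ← integral_const_mul]
    congr 1; ext s
    have : Complex.exp (Complex.I * z * t) =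
        Complex.exp (Complex.I * z * s) * Complex.exp (Complex.I * z * (t - s : ℝ)) := by
      rw [← Complex.exp_add]; congr 1; push_cast; ring
    rw [this]; ring
  rw [this]
  by_cases h0 : (f ⋆[ContinuousLinearMap.mul ℂ ℂ] g) t = 0
  · simp [h0]
  · rw [enorm_le_iff_norm_le, norm_mul]
    exact mul_le_of_le_one_left (norm_nonneg _) (norm_cexp_I_mul_le_one hz (hfg h0))

/-- Pointwise convolution bound on the semicircle: the product of the complex Fourier
transforms of the truncated exponential ψ and of a function h supported in [0,2] is
controlled by the homogeneous Bourgain-type weighted L² norm of ĥ. -/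
theorem semicircle_pointwise_convolution_bound :
    ∃ C : ℝ, 0 < C ∧ ∀ h : ℝ → ℂ, Measurable h → Integrable h → MemLp h 2 volume →
      Function.support h ⊆ Icc (0:ℝ) 2 →
      ∀ (k₁ : ℝ) (z : ℂ), 0 ≤ z.im →
        ENNReal.ofReal
            (‖(∫ t in (0:ℝ)..2, Complex.exp (Complex.I * z * (t:ℂ)) * Complex.exp (-(t:ℂ)))
              * (∫ t in (0:ℝ)..2, Complex.exp (Complex.I * ((k₁:ℂ)^2 + z) * (t:ℂ)) * h t)‖ ^ 2)
          ≤ ENNReal.ofReal C *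
              ∫⁻ τ : ℝ,
                ENNReal.ofReal ((1 + (τ + k₁^2)^2)⁻¹)
                  * (‖∫ t : ℝ, Complex.exp (-Complex.I * (τ:ℂ) * (t:ℂ)) * h t‖₊ : ℝ≥0∞) ^ 2 := by
  refine ⟨16, by norm_num, fun h _ hint _ hsupp k₁ z hz => ?_⟩
  set H : ℝ → ℂ := fun t => Complex.exp (Complex.I * (k₁ : ℂ) ^ 2 * t) * h t with hH
  have hHsupp : Function.support H ⊆ Icc 0 2 := fun t ht => hsupp (right_ne_zero_of_mul ht)
  have hexp (w : ℂ) : Integrable fun t : ℝ => Complex.exp (w * t) * h t := by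
    rw [← integrableOn_iff_integrable_of_support_subset
      (s := Icc 0 2) fun t ht => hsupp (right_ne_zero_of_mul ht)]
    exact hint.integrableOn.continuousOn_mul (by fun_prop) isCompact_Icc
  have hHi : Integrable H := hexp _
  have hmul : ∀ t : ℝ, Complex.exp (Complex.I * z * t) * H t =
      Complex.exp (Complex.I * ((k₁ : ℂ) ^ 2 + z) * t) * h t := fun t => by
    rw [hH, ← mul_assoc, ← Complex.exp_add]; ring_nf
  have hHint : ∫ t in (0 : ℝ)..2, Complex.exp (Complex.I * ((k₁ : ℂ) ^ 2 + z) * t) * h t =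
      ∫ t : ℝ, Complex.exp (Complex.I * z * t) * H t := by
    simp_rw [hmul]
    rw [intervalIntegral.integral_of_le zero_le_two, ← integral_Icc_eq_integral_Ioc]
    exact setIntegral_eq_integral_of_forall_compl_eq_zero fun t ht => by
      rw [Function.notMem_support.1 fun h' => ht (hsupp h'), mul_zero]
  have hFsupp : Function.support (truncExp ⋆[ContinuousLinearMap.mul ℂ ℂ] H) ⊆ Icc 0 4 := by
    refine (support_convolution_subset _).trans
      ((Set.add_subset_add support_truncExp_subset hHsupp).trans ?_)
    refine (Set.Icc_add_Icc_subset _ _ _ _).trans (Icc_subset_Icc ?_ ?_) <;> norm_num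
  have hψ : Integrable truncExp := by
    simpa using integrable_mul_truncExp (c := fun _ => 1) continuous_const
  have hfour (ξ : ℝ) : 𝓕 H ξ =
      ∫ t : ℝ, Complex.exp (-Complex.I * ((2 * Real.pi * ξ - k₁ ^ 2 : ℝ) : ℂ) * t) * h t := by
    rw [Real.fourier_eq_integral_cexp_mul]
    congr 1; ext t
    rw [hH, ← mul_assoc, ← Complex.exp_add]
    congr 2; push_cast; ring
  rw [hHint, ← integral_mul_truncExp, ENNReal.ofReal_pow (norm_nonneg _), ofReal_norm]
  calc _ ≤ (∫⁻ t, ‖(truncExp ⋆[ContinuousLinearMap.mul ℂ ℂ] H) t‖ₑ) ^ 2 := by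
        gcongr
        exact enorm_integral_mul_integral_le hz
          (integrable_mul_truncExp (c := fun t => Complex.exp (Complex.I * z * t)) (by fun_prop))
          (by simpa only [hmul] using hexp _) (hFsupp.trans Icc_subset_Ici_self)
    _ ≤ 4 * ∫⁻ t, ‖(truncExp ⋆[ContinuousLinearMap.mul ℂ ℂ] H) t‖ₑ ^ 2 := by
        simpa using sq_lintegral_enorm_le_of_support_subset
          (hψ.integrable_convolution _ hHi).1 hFsupp
    _ ≤ 4 * ∫⁻ ξ : ℝ, ENNReal.ofReal (4 * (1 + (2 * Real.pi * ξ) ^ 2)⁻¹) * ‖𝓕 H ξ‖ₑ ^ 2 := by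
        refine mul_le_mul_right ?_ 4
        exact lintegral_enorm_sq_truncExp_convolution_le hHi
    _ ≤ 4 * ∫⁻ τ : ℝ, ENNReal.ofReal (4 * (1 + (τ + k₁ ^ 2) ^ 2)⁻¹) *
          ‖∫ t : ℝ, Complex.exp (-Complex.I * (τ : ℂ) * t) * h t‖ₑ ^ 2 := by
        have hπ : 1 ≤ 2 * Real.pi := by linarith [Real.pi_gt_three]
        refine mul_le_mul_right (le_trans (le_of_eq ?_)
          (lintegral_comp_mul_left_sub hπ (k₁ ^ 2) _)) 4
        simp only [hfour, sub_add_cancel]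
    _ = _ := by
        simp_rw [ENNReal.ofReal_mul (zero_le_four (α := ℝ)), mul_assoc]
        rw [lintegral_const_mul' _ _ ENNReal.ofReal_ne_top, ← mul_assoc]
        congr 1
        norm_num [ENNReal.ofReal_ofNat]
end
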